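/- Fix a positive integer n and a real number x, and let x_n = max{ ⌊kx⌋/k : k = 1, 2, …, n }. Then x_n is the smallest real number y satisfying ⌊ky⌋ = ⌊kx⌋ for every k ∈ {1, …, n}: x_n itself satisfies ⌊k x_n⌋ = ⌊kx⌋ for all k ∈ {1, …, n}, and every real y with y < x_n fails to satisfy ⌊ky⌋ = ⌊kx⌋ for some k ∈ {1, …, n}. -/

import Mathlib

/-- For a positive integer `n` and a real `x`, the number
`x_n = max{⌊k x⌋/k : 1 ≤ k ≤ n}` is the least real `y` with `⌊k y⌋ = ⌊k x⌋` for all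
`k ∈ {1, …, n}`. -/
theorem xn_least_floor_equal (n : ℕ) (hn : 0 < n) (x : ℝ) (xn : ℝ)
    (hxn : IsGreatest ((fun k : ℕ => (⌊(k : ℝ) * x⌋ : ℝ) / (k : ℝ)) '' (Set.Icc 1 n)) xn) :
    IsLeast {y : ℝ | ∀ k ∈ Set.Icc 1 n, ⌊(k : ℝ) * y⌋ = ⌊(k : ℝ) * x⌋} xn := by
  obtain ⟨⟨m, hm, hmx⟩, hub⟩ := hxn
  have hpos : ∀ k ∈ Set.Icc 1 n, (0 : ℝ) < (k : ℝ) := by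
    intro k hk
    exact_mod_cast hk.1
  have hm0 := hpos m hm
  simp only at hmx
  constructor
  · intro k hk
    have hk0 := hpos k hk
    have hle : xn ≤ x := by
      rw [← hmx, div_le_iff₀ hm0, mul_comm x]
      exact Int.floor_le _
    apply le_antisymm
    · exact Int.floor_le_floor (mul_le_mul_of_nonneg_left hle hk0.le)
    · rw [Int.le_floor]
      have h := hub ⟨k, hk, rfl⟩
      simp only at h
      rwa [div_le_iff₀ hk0, mul_comm xn] at h
  · intro y hy
    have h := hy m hm
    rw [← hmx, div_le_iff₀ hm0, mul_comm y, ← h]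
    exact Int.floor_le _
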